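/- Under the sensitivity model, assume λ(g(X)) is integrable, Y(1) is integrable, and (1 − Φ(g(X)))·(f(X) + ρ·σ·λ(g(X))) is integrable. Then E[ (1 − Φ(g(X)))·(f(X) + ρ·σ·λ(g(X))) ] = E[ Y(1)·(1 − T) ] + ρ·σ·E[ λ(g(X)) ]. Consequently, when 0 < P(T = 0), the asymptotic confounding bias of the AIPW estimator of τ₁₀ = E(Y(1) | T = 0) equals ρ·σ·E(λ(g(X)))/P(T = 0). -/

import Mathlib

open MeasureTheory ProbabilityTheory Real

/-- The standard normal density φ(x) = (2π)^{-1/2} exp(-x²/2). -/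
noncomputable def stdNormalPDF (x : ℝ) : ℝ :=
  (Real.sqrt (2 * Real.pi))⁻¹ * Real.exp (-x ^ 2 / 2)

/-- The standard normal distribution function Φ(x) = ∫_{-∞}^x φ(t) dt. -/
noncomputable def stdNormalCDF (x : ℝ) : ℝ :=
  ∫ t in Set.Iic x, stdNormalPDF t

/-- The inverse Mills ratio λ(x) = φ(x)/Φ(x). -/
noncomputable def invMills (x : ℝ) : ℝ :=
  stdNormalPDF x / stdNormalCDF x

lemma stdNormalPDF_eq_gaussianPDFReal : stdNormalPDF = gaussianPDFReal 0 1 := by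
  ext x
  simp [stdNormalPDF, gaussianPDFReal]

lemma stdNormalPDF_pos (x : ℝ) : 0 < stdNormalPDF x := by
  rw [stdNormalPDF_eq_gaussianPDFReal]
  exact gaussianPDFReal_pos 0 1 x one_ne_zero

lemma integrable_stdNormalPDF : Integrable stdNormalPDF := by
  rw [stdNormalPDF_eq_gaussianPDFReal]
  exact integrable_gaussianPDFReal 0 1

lemma stdNormalCDF_eq_cdf : stdNormalCDF = cdf (gaussianReal 0 1) := by
  ext x
  rw [cdf_eq_real, measureReal_def, gaussianReal_apply_eq_integral 0 one_ne_zero,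
    ENNReal.toReal_ofReal (integral_nonneg fun y => gaussianPDFReal_nonneg 0 1 y),
    stdNormalCDF, stdNormalPDF_eq_gaussianPDFReal]

lemma measurable_stdNormalCDF : Measurable stdNormalCDF := by
  rw [stdNormalCDF_eq_cdf]
  exact (monotone_cdf _).measurable

lemma stdNormalCDF_nonneg (x : ℝ) : 0 ≤ stdNormalCDF x := by
  rw [stdNormalCDF_eq_cdf]
  exact cdf_nonneg _ x

lemma stdNormalCDF_le_one (x : ℝ) : stdNormalCDF x ≤ 1 := by
  rw [stdNormalCDF_eq_cdf]
  exact cdf_le_one _ x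

lemma stdNormalCDF_pos (x : ℝ) : 0 < stdNormalCDF x := by
  rw [stdNormalCDF, setIntegral_pos_iff_support_of_nonneg_ae
    (Filter.Eventually.of_forall fun y => (stdNormalPDF_pos y).le)
    integrable_stdNormalPDF.integrableOn,
    Function.support_eq_univ (fun y => (stdNormalPDF_pos y).ne')]
  simp

lemma stdNormalCDF_mul_invMills (x : ℝ) : stdNormalCDF x * invMills x = stdNormalPDF x :=
  mul_div_cancel₀ _ (stdNormalCDF_pos x).ne'

lemma stdNormalPDF_neg (x : ℝ) : stdNormalPDF (-x) = stdNormalPDF x := by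
  simp [stdNormalPDF]

lemma stdNormalCDF_neg (x : ℝ) : stdNormalCDF (-x) = 1 - stdNormalCDF x := by
  have h_total : ∫ y, stdNormalPDF y = 1 := by
    rw [stdNormalPDF_eq_gaussianPDFReal]
    exact integral_gaussianPDFReal_eq_one 0 one_ne_zero
  have h_split := intervalIntegral.integral_Iic_add_Ioi (b := x)
    integrable_stdNormalPDF.integrableOn integrable_stdNormalPDF.integrableOn
  have h_reflect := integral_comp_neg_Iic (-x) stdNormalPDF
  simp only [stdNormalPDF_neg, neg_neg] at h_reflect
  rw [h_total, ← h_reflect] at h_split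
  simp only [stdNormalCDF]
  linarith

lemma setIntegral_Iic_gaussianReal_zero_one_one (x : ℝ) :
    ∫ _ in Set.Iic x, (1 : ℝ) ∂gaussianReal 0 1 = stdNormalCDF x := by
  simp [stdNormalCDF_eq_cdf, cdf_eq_real]

lemma hasDerivAt_stdNormalPDF (x : ℝ) : HasDerivAt stdNormalPDF (-(x * stdNormalPDF x)) x := by
  have h : HasDerivAt (fun y : ℝ => -y ^ 2 / 2) (-x) x :=
    ((hasDerivAt_pow 2 x).neg.div_const 2).congr_deriv (by norm_num; ring)
  refine (h.exp.const_mul (√(2 * π))⁻¹).congr_deriv ?_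
  rw [stdNormalPDF]
  ring

lemma integrable_id_gaussianReal (μ : ℝ) (v : NNReal) :
    Integrable (fun y => y) (gaussianReal μ v) :=
  memLp_one_iff_integrable.1 (memLp_id_gaussianReal' 1 ENNReal.one_ne_top)

lemma integrable_mul_stdNormalPDF : Integrable fun y => y * stdNormalPDF y := by
  have h := integrable_mul_exp_neg_mul_sq (b := 1 / 2) (by norm_num)
  convert h.const_mul (√(2 * π))⁻¹ using 2 with y
  rw [stdNormalPDF, show -y ^ 2 / 2 = -(1 / 2) * y ^ 2 by ring]
  ring

lemma tendsto_stdNormalPDF_atBot : Filter.Tendsto stdNormalPDF Filter.atBot (nhds 0) := by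
  have h : Filter.Tendsto (fun y : ℝ => -y ^ 2 / 2) Filter.atBot Filter.atBot := by
    have hsq : Filter.Tendsto (fun y : ℝ => y ^ 2) Filter.atBot Filter.atTop := by
      simpa [Function.comp_def] using (Filter.tendsto_pow_atTop (α := ℝ) two_ne_zero).comp
        Filter.tendsto_neg_atBot_atTop
    exact (Filter.tendsto_neg_atTop_atBot.comp hsq).atBot_div_const two_pos
  rw [← mul_zero (√(2 * π))⁻¹]
  exact (tendsto_exp_atBot.comp h).const_mul _

lemma setIntegral_Iic_gaussianReal_zero_one_id (x : ℝ) :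
    ∫ y in Set.Iic x, y ∂gaussianReal 0 1 = -stdNormalPDF x := by
  have h := integral_Iic_of_hasDerivAt_of_tendsto (a := x)
    (hasDerivAt_stdNormalPDF x).continuousAt.continuousWithinAt
    (fun y _ => hasDerivAt_stdNormalPDF y) integrable_mul_stdNormalPDF.neg.integrableOn
    tendsto_stdNormalPDF_atBot
  rw [integral_neg, sub_zero] at h
  rw [← h, neg_neg, ← integral_indicator measurableSet_Iic,
    integral_gaussianReal_eq_integral_smul one_ne_zero, ← integral_indicator measurableSet_Iic,
    stdNormalPDF_eq_gaussianPDFReal]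
  congr 1 with y
  by_cases hy : y ∈ Set.Iic x <;> simp [hy, mul_comm]

lemma ProbabilityTheory.IndepFun.integral_comp_prodMk {Ω E F G : Type*} [MeasurableSpace Ω]
    [MeasurableSpace E] [MeasurableSpace F] [NormedAddCommGroup G] [NormedSpace ℝ G]
    {P : Measure Ω} [IsFiniteMeasure P] {X : Ω → E} {Y : Ω → F} (hXY : IndepFun X Y P)
    (hX : Measurable X) (hY : Measurable Y) {h : E × F → G} (hh : StronglyMeasurable h)
    (hint : Integrable (fun ω => h (X ω, Y ω)) P) :
    ∫ ω, h (X ω, Y ω) ∂P = ∫ ω, ∫ y, h (X ω, y) ∂P.map Y ∂P := by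
  have hXYm : AEMeasurable (fun ω => (X ω, Y ω)) P := (hX.prodMk hY).aemeasurable
  have hmap := hXY.map_prod_eq_prod_map_map hX.aemeasurable hY.aemeasurable
  have hint' : Integrable h ((P.map X).prod (P.map Y)) := by
    rw [← hmap]
    exact (integrable_map_measure hh.aestronglyMeasurable hXYm).2 hint
  rw [← integral_map hXYm hh.aestronglyMeasurable, hmap, integral_prod h hint',
    integral_map hX.aemeasurable hh.integral_prod_right'.aestronglyMeasurable]

/-- Integrating out a variable `Y` independent of `X` on the event `Y ≤ a X`. -/
lemma ProbabilityTheory.IndepFun.integral_mul_indicator_Iic {Ω E : Type*} [MeasurableSpace Ω]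
    [MeasurableSpace E] {P : Measure Ω} [IsFiniteMeasure P] {X : Ω → E} {Y : Ω → ℝ}
    (hXY : IndepFun X Y P) (hX : Measurable X) (hY : Measurable Y) {u a : E → ℝ} {k : ℝ → ℝ}
    (hu : Measurable u) (ha : Measurable a) (hk : Measurable k)
    (hint : Integrable (fun ω => u (X ω) * (Set.Iic (a (X ω))).indicator k (Y ω)) P) :
    ∫ ω, u (X ω) * (Set.Iic (a (X ω))).indicator k (Y ω) ∂P =
      ∫ ω, u (X ω) * ∫ y in Set.Iic (a (X ω)), k y ∂P.map Y ∂P := by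
  have hind : Measurable fun p : E × ℝ => (Set.Iic (a p.1)).indicator k p.2 := by
    have : (fun p : E × ℝ => (Set.Iic (a p.1)).indicator k p.2) =
        {p : E × ℝ | p.2 ≤ a p.1}.indicator fun p => k p.2 := by
      ext p
      simp [Set.indicator_apply]
    rw [this]
    exact (hk.comp measurable_snd).indicator
      (measurableSet_le measurable_snd (ha.comp measurable_fst))
  rw [hXY.integral_comp_prodMk hX hY
    (h := fun p => u p.1 * (Set.Iic (a p.1)).indicator k p.2)
    ((hu.comp measurable_fst).mul hind).stronglyMeasurable hint]
  simp only [integral_const_mul, integral_indicator measurableSet_Iic]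

/-- Under the sensitivity model, if `λ(g(X))`, `Y(1)` and
`(1 − Φ(g(X)))·(f(X) + ρσλ(g(X)))` are integrable, then
`E[(1 − Φ(g(X)))·(f(X) + ρσλ(g(X)))] = E[Y(1)·(1 − T)] + ρσ·E[λ(g(X))]`.
Consequently, when `0 < P(T = 0)`, the asymptotic confounding bias of the AIPW estimator
of `τ₁₀ = E(Y(1) | T = 0)` equals `ρσ·E(λ(g(X)))/P(T = 0)`. -/
theorem bias_treated_on_controls
    {Ω : Type*} [MeasurableSpace Ω] {P : Measure Ω} [IsProbabilityMeasure P]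
    {E : Type*} [MeasurableSpace E]
    (X : Ω → E) (hX : Measurable X)
    (η : Ω → ℝ) (hη : Measurable η)
    (hlaw : Measure.map η P = gaussianReal 0 1)
    (hindep : IndepFun η X P)
    (ε : Ω → ℝ) (hε : Measurable ε)
    (hεInt : Integrable ε P) (hεMean : ∫ ω, ε ω ∂P = 0)
    (hεIndep : IndepFun ε (fun ω => (X ω, η ω)) P)
    (ρ σ : ℝ) (hσ : 0 ≤ σ)
    (f g : E → ℝ) (hf : Measurable f) (hg : Measurable g)
    (hfInt : Integrable (fun ω => f (X ω)) P)
    (ξ : Ω → ℝ) (hξ : ∀ ω, ξ ω = ρ * σ * η ω + ε ω)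
    (Y1 : Ω → ℝ) (hY1 : ∀ ω, Y1 ω = f (X ω) + ξ ω)
    (T : Ω → ℝ) (hT : ∀ ω, T ω = if 0 < g (X ω) + η ω then 1 else 0)
    (hMills : Integrable (fun ω => invMills (g (X ω))) P)
    (hY1Int : Integrable Y1 P)
    (hmInt : Integrable (fun ω =>
      (1 - stdNormalCDF (g (X ω))) * (f (X ω) + ρ * σ * invMills (g (X ω)))) P) :
    (∫ ω, (1 - stdNormalCDF (g (X ω))) * (f (X ω) + ρ * σ * invMills (g (X ω))) ∂P
        = (∫ ω, Y1 ω * (1 - T ω) ∂P) + ρ * σ * ∫ ω, invMills (g (X ω)) ∂P) ∧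
    (0 < ∫ ω, (1 - T ω) ∂P →
      (∫ ω, (1 - stdNormalCDF (g (X ω))) * (f (X ω) + ρ * σ * invMills (g (X ω))) ∂P) /
          (∫ ω, (1 - T ω) ∂P)
        - (∫ ω, Y1 ω * (1 - T ω) ∂P) / (∫ ω, (1 - T ω) ∂P)
        = ρ * σ * (∫ ω, invMills (g (X ω)) ∂P) / (∫ ω, (1 - T ω) ∂P)) := by
  have hXη : IndepFun X η P := hindep.symm
  set D : Ω → ℝ := fun ω => (Set.Iic (-g (X ω))).indicator 1 (η ω) with hD
  have hDT (ω : Ω) : 1 - T ω = D ω := by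
    by_cases h : 0 < g (X ω) + η ω
    · have : ¬ η ω ≤ -g (X ω) := by linarith
      simp [hT, hD, h, this]
    · have : η ω ≤ -g (X ω) := by linarith
      simp [hT, hD, h, this]
  let d : E × ℝ → ℝ := {p : E × ℝ | p.2 ≤ -g p.1}.indicator 1
  have hd : Measurable d := measurable_one.indicator
    (measurableSet_le measurable_snd (hg.comp measurable_fst).neg)
  have hdD (ω : Ω) : d (X ω, η ω) = D ω := by simp [d, hD, Set.indicator_apply]
  have hDm : Measurable D := by
    rw [← funext hdD]
    exact hd.comp (hX.prodMk hη)
  have hDbdd (ω : Ω) : ‖D ω‖ ≤ 1 := by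
    simp only [hD, Set.indicator_apply]
    split_ifs <;> simp
  have h_mul_D {u : Ω → ℝ} (hu : Integrable u P) : Integrable (fun ω => u ω * D ω) P :=
    hu.mul_bdd (c := 1) hDm.aestronglyMeasurable (.of_forall hDbdd)
  have hηInt : Integrable η P := by
    have := integrable_id_gaussianReal 0 1
    rw [← hlaw] at this
    exact this.comp_measurable hη
  have h_f : ∫ ω, f (X ω) * D ω ∂P = ∫ ω, f (X ω) * (1 - stdNormalCDF (g (X ω))) ∂P := by
    rw [hXη.integral_mul_indicator_Iic (a := fun x => -g x) hX hη hf hg.neg measurable_one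
      (h_mul_D hfInt), hlaw]
    simp only [Pi.one_apply, setIntegral_Iic_gaussianReal_zero_one_one,
      stdNormalCDF_neg]
  have h_η : ∫ ω, η ω * D ω ∂P = -∫ ω, stdNormalPDF (g (X ω)) ∂P := by
    have h_ind (ω : Ω) : η ω * D ω = 1 * (Set.Iic (-g (X ω))).indicator (fun y => y) (η ω) := by
      simp [hD, Set.indicator_apply]
    have h_int := h_mul_D hηInt
    simp only [h_ind] at h_int ⊢
    rw [hXη.integral_mul_indicator_Iic (u := fun _ => 1) (a := fun x => -g x) hX hη
      measurable_const hg.neg measurable_id' h_int, hlaw]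
    simp only [setIntegral_Iic_gaussianReal_zero_one_id, stdNormalPDF_neg,
      one_mul, integral_neg]
  have h_ε : ∫ ω, ε ω * D ω ∂P = 0 := by
    have h_indep : IndepFun ε D P := by
      simpa only [Function.comp_def, id, hdD] using hεIndep.comp measurable_id hd
    rw [h_indep.integral_fun_mul_eq_mul_integral hε.aestronglyMeasurable
      hDm.aestronglyMeasurable, hεMean, zero_mul]
  have h_Y1 : ∫ ω, Y1 ω * (1 - T ω) ∂P =
      ∫ ω, f (X ω) * (1 - stdNormalCDF (g (X ω))) ∂P
        - ρ * σ * ∫ ω, stdNormalPDF (g (X ω)) ∂P := by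
    have h_expand (ω : Ω) :
        Y1 ω * (1 - T ω) = f (X ω) * D ω + ρ * σ * (η ω * D ω) + ε ω * D ω := by
      rw [hDT, hY1, hξ]
      ring
    simp only [h_expand]
    rw [integral_add ((h_mul_D hfInt).fun_add ((h_mul_D hηInt).const_mul _)) (h_mul_D hεInt),
      integral_add (h_mul_D hfInt) ((h_mul_D hηInt).const_mul _), integral_const_mul,
      h_f, h_η, h_ε]
    ring
  have hΦm : Measurable fun ω => stdNormalCDF (g (X ω)) :=
    measurable_stdNormalCDF.comp (hg.comp hX)
  have hfΦInt : Integrable (fun ω => f (X ω) * (1 - stdNormalCDF (g (X ω)))) P := by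
    refine hfInt.mul_bdd (c := 1) (measurable_const.sub hΦm).aestronglyMeasurable (.of_forall fun ω => ?_)
    rw [Real.norm_eq_abs, abs_le]
    constructor <;> linarith [stdNormalCDF_nonneg (g (X ω)), stdNormalCDF_le_one (g (X ω))]
  have hφInt : Integrable (fun ω => stdNormalPDF (g (X ω))) P := by
    simp only [← stdNormalCDF_mul_invMills]
    refine hMills.bdd_mul (c := 1) hΦm.aestronglyMeasurable (.of_forall fun ω => ?_)
    rw [Real.norm_eq_abs, abs_of_nonneg (stdNormalCDF_nonneg _)]
    exact stdNormalCDF_le_one _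
  have h_main : ∫ ω, (1 - stdNormalCDF (g (X ω))) * (f (X ω) + ρ * σ * invMills (g (X ω))) ∂P
      = (∫ ω, Y1 ω * (1 - T ω) ∂P) + ρ * σ * ∫ ω, invMills (g (X ω)) ∂P := by
    have h_expand (ω : Ω) :
        (1 - stdNormalCDF (g (X ω))) * (f (X ω) + ρ * σ * invMills (g (X ω))) =
          f (X ω) * (1 - stdNormalCDF (g (X ω)))
            + ρ * σ * invMills (g (X ω)) - ρ * σ * stdNormalPDF (g (X ω)) := by
      rw [← stdNormalCDF_mul_invMills]
      ring
    simp only [h_expand]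
    rw [integral_sub (hfΦInt.fun_add (hMills.const_mul _)) (hφInt.const_mul _),
      integral_add hfΦInt (hMills.const_mul _), integral_const_mul, integral_const_mul, h_Y1]
    ring
  refine ⟨h_main, fun _ => ?_⟩
  rw [h_main]
  ring
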